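/- Let T be a finite set of observations, for each t ∈ T let m^t > 0, p̄^t ∈ ℝ^K_{++}, and let μ^t be a Borel probability measure on the expenditure simplex 𝓔^t = {e ∈ ℝ^K_+ : ∑_k e_k = m^t}. Fix a nonempty R ⊆ K with μ^t({e ∈ 𝓔^t : e_k > 0 for all k ∈ R}) = 1 for each t. Suppose {(μ^t, p̄^t)}_{t∈T} is RUM-rationalizable: there exist a probability space (Ω, 𝓕, P) and a family (u_ω)_{ω∈Ω} of strictly increasing, strictly concave, continuous utility functions on ℝ^K_+ such that, letting e^{ω,t} denote the unique maximizer of e ↦ u_ω(x(e, p̄^t)) over 𝓔^t, the map ω ↦ e^{ω,t} is measurable and μ^t is the pushforward of P under it, for each t. Then for every ε > 0 there exist Borel probability measures μ̂^t on 𝓔^t with Lévy–Prokhorov distance d_LP(μ^t, μ̂^t) < ε for every t ∈ T, such that {(μ̂^t, p̄^t)}_{t∈T} is RPM-rationalizable with consistency in expectation: there exist a Borel probability measure η on ℝ_{++} with ∫ λ dη(λ) = 1 and a strictly increasing, strictly concave, continuous utility function u: ℝ^K_+ → ℝ such that, writing p^{λ,t} = (λ p̄^t_R, p̄^t_{−R})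 and letting e^{λ,t} denote the unique maximizer of e ↦ u(x(e, p^{λ,t})) over 𝓔^t, the map λ ↦ e^{λ,t} is measurable and μ̂^t is the pushforward of η under it, for every t. -/

import Mathlib

open Filter Set MeasureTheory

noncomputable section

/-- The inner product `p·x = ∑ k, p k * x k`. -/
def dotp {K : ℕ} (p x : Fin K → ℝ) : ℝ := ∑ k, p k * x k

/-- The implied bundle `x(e,p) = (e_k / p_k)_k`. -/
def demandOf {K : ℕ} (e p : Fin K → ℝ) : Fin K → ℝ := fun k => e k / p k

/-- The budget set `B(p,m) = {x ∈ ℝ^K_+ : p·x ≤ m}`. -/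
def budget {K : ℕ} (p : Fin K → ℝ) (m : ℝ) : Set (Fin K → ℝ) :=
  {x | (∀ k, 0 ≤ x k) ∧ dotp p x ≤ m}

/-- A utility function on `ℝ^K_+`: continuous and strictly increasing. -/
def IsUtility {K : ℕ} (u : (Fin K → ℝ) → ℝ) : Prop :=
  ContinuousOn u {x | ∀ k, 0 ≤ x k} ∧
  ∀ x y : Fin K → ℝ, (∀ k, 0 ≤ x k) → (∀ k, 0 ≤ y k) →
    (∀ k, x k ≤ y k) → (∃ k, x k < y k) → u x < u y

/-- Basic data-set conditions: expenditures are nonnegative with positive total,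
and price indices are strictly positive. -/
def IsDataset {N T K : ℕ} (e : Fin N → Fin T → Fin K → ℝ)
    (pbar : Fin T → Fin K → ℝ) : Prop :=
  (∀ i t k, 0 ≤ e i t k) ∧ (∀ i t, 0 < ∑ k, e i t k) ∧ (∀ t k, 0 < pbar t k)

/-- The expenditure simplex `{e ∈ ℝ^K_+ : ∑ k, e k = m}`. -/
def simplexE {K : ℕ} (m : ℝ) : Set (Fin K → ℝ) := {e | (∀ k, 0 ≤ e k) ∧ ∑ k, e k = m}

/-- A strictly increasing, strictly concave and continuous utility function on `ℝ^K_+`. -/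
def IsNiceUtility {K : ℕ} (u : (Fin K → ℝ) → ℝ) : Prop :=
  IsUtility u ∧ StrictConcaveOn ℝ {x : Fin K → ℝ | ∀ k, 0 ≤ x k} u

/-- The price vector `p^{λ,t}` obtained from `p̄^t` by scaling the coordinates in `R`
by `λ`. -/
def plamR {T K : ℕ} (R : Finset (Fin K)) (pbar : Fin T → Fin K → ℝ) (lam : ℝ)
    (t : Fin T) : Fin K → ℝ :=
  fun k => if k ∈ R then lam * pbar t k else pbar t k

/-- Maximum theorem for unique maximizers over a compact space. -/
lemma continuous_argmax {X S : Type*} [TopologicalSpace X] [TopologicalSpace S] [CompactSpace S]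
    (f : X → S → ℝ) (hf : Continuous fun q : X × S => f q.1 q.2) (g : X → S)
    (hg : ∀ x e, f x e ≤ f x (g x))
    (huniq : ∀ x e, (∀ e', f x e' ≤ f x e) → e = g x) : Continuous g := by
  rw [continuous_iff_isClosed]
  intro C hC
  have hG : IsClosed {q : X × S | (∀ e', f q.1 e' ≤ f q.1 q.2) ∧ q.2 ∈ C} := by
    have : {q : X × S | (∀ e', f q.1 e' ≤ f q.1 q.2) ∧ q.2 ∈ C}
        = (⋂ e', {q : X × S | f q.1 e' ≤ f q.1 q.2}) ∩ Prod.snd ⁻¹' C := by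
      ext q; simp
    rw [this]
    refine IsClosed.inter ?_ (hC.preimage continuous_snd)
    refine isClosed_iInter fun e' => isClosed_le ?_ hf
    exact hf.comp (continuous_fst.prodMk continuous_const)
  have := isClosedMap_fst_of_compactSpace (X := X) (Y := S) _ hG
  convert this using 1
  ext x
  constructor
  · intro hx
    exact ⟨(x, g x), ⟨hg x, hx⟩, rfl⟩
  · rintro ⟨⟨x', e⟩, ⟨h1, h2⟩, rfl⟩
    have := huniq _ _ h1
    simp only at this h2
    rw [this] at h2
    exact h2

lemma convex_orthant (K : ℕ) : Convex ℝ {x : Fin K → ℝ | ∀ k, 0 ≤ x k} := by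
  intro x hx y hy a b ha hb _ k
  have := mul_nonneg ha (hx k)
  have := mul_nonneg hb (hy k)
  simp only [Pi.add_apply, Pi.smul_apply, smul_eq_mul]
  linarith

lemma dotp_comb {K : ℕ} (p x y : Fin K → ℝ) (a b : ℝ) :
    dotp p (a • x + b • y) = a * dotp p x + b * dotp p y := by
  simp only [dotp, Finset.mul_sum, ← Finset.sum_add_distrib]
  refine Finset.sum_congr rfl fun k _ => ?_
  simp only [Pi.add_apply, Pi.smul_apply, smul_eq_mul]
  ring

lemma IsUtility.mono {K : ℕ} {u : (Fin K → ℝ) → ℝ} (hu : IsUtility u) {x y : Fin K → ℝ}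
    (hx : ∀ k, 0 ≤ x k) (hy : ∀ k, 0 ≤ y k) (hxy : ∀ k, x k ≤ y k) : u x ≤ u y := by
  by_cases h : ∃ k, x k < y k
  · exact (hu.2 x y hx hy hxy h).le
  · push Not at h
    have : x = y := funext fun k => le_antisymm (hxy k) (h k)
    rw [this]

/-- Existence of a positive Lagrange multiplier. -/
lemma exists_multiplier {K : ℕ} (k0 : Fin K) {u : (Fin K → ℝ) → ℝ} (hu : IsNiceUtility u)
    (p : Fin K → ℝ) (hp : ∀ k, 0 < p k) (m : ℝ) (hm : 0 < m) (x0 : Fin K → ℝ)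
    (hx0 : ∀ k, 0 ≤ x0 k) (hpx0 : dotp p x0 = m)
    (hmax : ∀ x : Fin K → ℝ, (∀ k, 0 ≤ x k) → dotp p x = m → u x ≤ u x0) :
    ∃ L : ℝ, 0 < L ∧ ∀ x : Fin K → ℝ, (∀ k, 0 ≤ x k) → u x ≤ u x0 + L * (dotp p x - m) := by
  have key : ∀ x y : Fin K → ℝ, (∀ k, 0 ≤ x k) → (∀ k, 0 ≤ y k) → m < dotp p x → dotp p y < m →
      (u x - u x0) * (m - dotp p y) ≤ (u x0 - u y) * (dotp p x - m) := by
    intro x y hx hy h1 h2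
    set c := dotp p x
    set d := dotp p y
    have hcd : 0 < c - d := by linarith
    have ha : 0 ≤ (m - d) / (c - d) := div_nonneg (by linarith) hcd.le
    have hb : 0 ≤ (c - m) / (c - d) := div_nonneg (by linarith) hcd.le
    have hab : (m - d) / (c - d) + (c - m) / (c - d) = 1 := by field_simp; ring
    have h3 := hu.2.concaveOn.2 (x := x) hx (y := y) hy ha hb hab
    have h4 := hmax (((m - d) / (c - d)) • x + ((c - m) / (c - d)) • y)
      (convex_orthant K (x := x) hx (y := y) hy ha hb hab) (by
        rw [dotp_comb]; change _ * c + _ * d = m; field_simp; ring)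
    have h5 := h3.trans h4
    simp only [smul_eq_mul] at h5
    rw [div_mul_eq_mul_div, div_mul_eq_mul_div, ← add_div, div_le_iff₀ hcd] at h5
    nlinarith
  set A : Set ℝ := {q | ∃ x : Fin K → ℝ, (∀ k, 0 ≤ x k) ∧ m < dotp p x ∧
    q = (u x - u x0) / (dotp p x - m)} with hA
  have hbd : ∀ y : Fin K → ℝ, (∀ k, 0 ≤ y k) → dotp p y < m → ∀ q ∈ A,
      q ≤ (u x0 - u y) / (m - dotp p y) := by
    rintro y hy h2 q ⟨x, hx, h1, rfl⟩
    rw [div_le_div_iff₀ (by linarith) (by linarith)]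
    exact key x y hx hy h1 h2
  have h0 : dotp p (0 : Fin K → ℝ) < m := by simpa [dotp] using hm
  have hAb : BddAbove A := ⟨_, fun q hq => hbd 0 (fun _ => le_rfl) h0 q hq⟩
  -- a point above
  have hup : ∃ q ∈ A, 0 < q := by
    have hx1 : ∀ k, 0 ≤ (x0 + 1) k := fun k => by
      have := hx0 k; simp only [Pi.add_apply, Pi.one_apply]; linarith
    have hd : m < dotp p (x0 + 1) := by
      have h1 := dotp_comb p x0 1 1 1
      simp only [one_smul, one_mul] at h1
      rw [h1, hpx0]
      have : 0 < dotp p 1 := by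
        simp only [dotp, Pi.one_apply, mul_one]
        exact Finset.sum_pos (fun k _ => hp k) ⟨k0, Finset.mem_univ _⟩
      linarith
    refine ⟨_, ⟨x0 + 1, hx1, hd, rfl⟩, div_pos ?_ (by linarith)⟩
    have := hu.1.2 x0 (x0 + 1) hx0 hx1 (fun k => by simp) ⟨k0, by simp⟩
    linarith
  obtain ⟨q0, hq0, hq0p⟩ := hup
  refine ⟨sSup A, hq0p.trans_le (le_csSup hAb hq0), fun x hx => ?_⟩
  rcases lt_trichotomy (dotp p x) m with h | h | h
  · have h1 : sSup A ≤ (u x0 - u x) / (m - dotp p x) :=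
      csSup_le ⟨q0, hq0⟩ (hbd x hx h)
    rw [le_div_iff₀ (by linarith)] at h1
    linarith
  · rw [h]; simpa using hmax x hx h
  · have h1 : (u x - u x0) / (dotp p x - m) ≤ sSup A := le_csSup hAb ⟨x, hx, h, rfl⟩
    rw [div_le_iff₀ (by linarith)] at h1
    linarith

lemma continuous_dotp {K : ℕ} (p : Fin K → ℝ) : Continuous (dotp p) := by
  unfold dotp; fun_prop

lemma dotp_mono {K : ℕ} (p : Fin K → ℝ) (hp : ∀ k, 0 < p k) {x y : Fin K → ℝ}
    (h : ∀ k, x k ≤ y k) : dotp p x ≤ dotp p y :=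
  Finset.sum_le_sum fun k _ => mul_le_mul_of_nonneg_left (h k) (hp k).le

lemma le_dotp {K : ℕ} (p : Fin K → ℝ) (hp : ∀ k, 0 < p k) {x : Fin K → ℝ}
    (hx : ∀ k, 0 ≤ x k) (k : Fin K) : p k * x k ≤ dotp p x :=
  Finset.single_le_sum (f := fun k => p k * x k)
    (fun k _ => mul_nonneg (hp k).le (hx k)) (Finset.mem_univ k)

/-- A linear form with positive coefficients is coercive. -/
lemma dotp_growth {K : ℕ} (p : Fin K → ℝ) (hp : ∀ k, 0 < p k) (C : ℝ) :
    ∃ B : ℝ, ∀ x : Fin K → ℝ, (∀ k, 0 ≤ x k) → (∃ k, B ≤ x k) → C ≤ dotp p x := by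
  refine ⟨∑ k, |C| / p k, fun x hx ⟨k, hk⟩ => ?_⟩
  have h1 : |C| / p k ≤ ∑ k, |C| / p k :=
    Finset.single_le_sum (f := fun k => |C| / p k)
      (fun k _ => div_nonneg (abs_nonneg _) (hp k).le) (Finset.mem_univ k)
  have h2 := h1.trans hk
  rw [div_le_iff₀ (hp k)] at h2
  have := le_dotp p hp hx k
  have := le_abs_self C
  linarith

lemma affine_concave {K : ℕ} (p : Fin K → ℝ) (a L m : ℝ) :
    ConcaveOn ℝ {x : Fin K → ℝ | ∀ k, 0 ≤ x k} (fun x => a + L * (dotp p x - m)) := by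
  refine ⟨convex_orthant K, ?_⟩
  intro x _ y _ s t _ _ hst
  simp only [dotp_comb, smul_eq_mul]
  have : t = 1 - s := by linarith
  subst this
  apply le_of_eq
  ring

lemma exists_envelope {T K : ℕ} (k0 : Fin K) {u : (Fin K → ℝ) → ℝ} (hu : IsNiceUtility u)
    (p : Fin T → Fin K → ℝ) (hp : ∀ t k, 0 < p t k) (m : Fin T → ℝ) (hm : ∀ t, 0 < m t)
    (x0 : Fin T → Fin K → ℝ)
    (hx0 : ∀ t k, 0 ≤ x0 t k) (hpx0 : ∀ t, dotp (p t) (x0 t) = m t)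
    (hmax : ∀ t, ∀ x : Fin K → ℝ, (∀ k, 0 ≤ x k) → dotp (p t) x = m t → u x ≤ u (x0 t))
    (s : Finset (Fin T)) :
    ∃ h : (Fin K → ℝ) → ℝ, ConcaveOn ℝ {x : Fin K → ℝ | ∀ k, 0 ≤ x k} h ∧
      ContinuousOn h {x : Fin K → ℝ | ∀ k, 0 ≤ x k} ∧
      (∀ x y : Fin K → ℝ, (∀ k, 0 ≤ x k) → (∀ k, 0 ≤ y k) → (∀ k, x k ≤ y k) → h x ≤ h y) ∧
      (∀ C : ℝ, ∃ B : ℝ, ∀ x : Fin K → ℝ, (∀ k, 0 ≤ x k) → (∃ k, B ≤ x k) → C ≤ h x) ∧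
      (∀ x : Fin K → ℝ, (∀ k, 0 ≤ x k) → u x ≤ h x) ∧
      (∀ t ∈ s, ∀ x : Fin K → ℝ, (∀ k, 0 ≤ x k) → dotp (p t) x = m t → h x ≤ u (x0 t)) := by
  induction s using Finset.induction_on with
  | empty =>
    refine ⟨fun x => u x + (0 + 1 * (dotp (fun _ => 1) x - 0)), ?_, ?_, ?_, ?_, ?_, by simp⟩
    · exact hu.2.concaveOn.add (affine_concave _ _ _ _)
    · refine hu.1.1.add (Continuous.continuousOn ?_)
      have := continuous_dotp (K := K) (fun _ => 1)
      fun_prop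
    · intro x y hx hy hxy
      have h1 := hu.1.mono hx hy hxy
      have h2 := dotp_mono (fun _ => 1) (fun _ => one_pos) hxy
      linarith
    · intro C
      obtain ⟨B, hB⟩ := dotp_growth (K := K) (fun _ => 1) (fun _ => one_pos) (C - u 0)
      refine ⟨B, fun x hx hk => ?_⟩
      have h1 := hB x hx hk
      have h2 := hu.1.mono (x := 0) (fun _ => le_rfl) hx hx
      linarith
    · intro x hx
      have : 0 ≤ dotp (fun _ => 1) x := Finset.sum_nonneg fun k _ => by simpa using hx k
      linarith
  | insert t s _ ih =>
    obtain ⟨h, hc, hcont, hmono, hgr, hle, hb⟩ := ih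
    obtain ⟨L, hL, hLx⟩ := exists_multiplier k0 hu (p t) (hp t) (m t) (hm t) (x0 t) (hx0 t)
      (hpx0 t) (hmax t)
    refine ⟨h ⊓ fun x => u (x0 t) + L * (dotp (p t) x - m t), hc.inf (affine_concave _ _ _ _),
      hcont.inf (Continuous.continuousOn ?_), ?_, ?_, ?_, ?_⟩
    · have := continuous_dotp (p t)
      fun_prop
    · intro x y hx hy hxy
      refine inf_le_inf (hmono x y hx hy hxy) ?_
      have h2 := mul_le_mul_of_nonneg_left (dotp_mono (p t) (hp t) hxy) hL.le
      simp only [mul_sub]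
      linarith
    · intro C
      obtain ⟨B, hB⟩ := hgr C
      obtain ⟨B', hB'⟩ := dotp_growth (p t) (hp t) ((C - u (x0 t)) / L + m t)
      refine ⟨max B B', fun x hx ⟨k, hk⟩ => le_inf (hB x hx ⟨k, (le_max_left _ _).trans hk⟩) ?_⟩
      have h1 := hB' x hx ⟨k, (le_max_right _ _).trans hk⟩
      have h2 : (C - u (x0 t)) / L ≤ dotp (p t) x - m t := by linarith
      rw [div_le_iff₀ hL] at h2
      simp only
      linarith
    · intro x hx
      exact le_inf (hle x hx) (hLx x hx)
    · intro t' ht' x hx hpx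
      rcases Finset.mem_insert.1 ht' with rfl | ht'
      · refine inf_le_right.trans ?_
        simp [hpx]
      · exact inf_le_left.trans (hb t' ht' x hx hpx)

lemma demandOf_mem {K : ℕ} {p e : Fin K → ℝ} {m : ℝ} (hp : ∀ k, 0 < p k) (he : e ∈ simplexE m) :
    (∀ k, 0 ≤ demandOf e p k) ∧ dotp p (demandOf e p) = m := by
  refine ⟨fun k => div_nonneg (he.1 k) (hp k).le, ?_⟩
  rw [← he.2]
  refine Finset.sum_congr rfl fun k _ => ?_
  have := (hp k).ne'
  simp only [demandOf]
  field_simp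

/-- Replacing a utility by a coercive one with the same demand. -/
lemma exists_coercive {T K : ℕ} (k0 : Fin K) {u : (Fin K → ℝ) → ℝ} (hu : IsNiceUtility u)
    (p : Fin T → Fin K → ℝ) (hp : ∀ t k, 0 < p t k) (m : Fin T → ℝ) (hm : ∀ t, 0 < m t)
    (E : Fin T → Fin K → ℝ) (hE : ∀ t, E t ∈ simplexE (m t))
    (hmax : ∀ t, ∀ e ∈ simplexE (m t), u (demandOf e (p t)) ≤ u (demandOf (E t) (p t))) :
    ∃ w : (Fin K → ℝ) → ℝ, IsNiceUtility w ∧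
      (∀ t, ∀ e ∈ simplexE (m t), w (demandOf e (p t)) ≤ w (demandOf (E t) (p t))) ∧
      (∀ C : ℝ, ∃ B : ℝ, ∀ x : Fin K → ℝ, (∀ k, 0 ≤ x k) → (∃ k, B ≤ x k) → C ≤ w x) := by
  obtain ⟨h, hc, hcont, hmono, hgr, hle, hb⟩ := exists_envelope k0 hu p hp m hm
    (fun t => demandOf (E t) (p t)) (fun t => (demandOf_mem (hp t) (hE t)).1)
    (fun t => (demandOf_mem (hp t) (hE t)).2) (by
      intro t x hx hpx
      have h1 := hmax t (fun k => p t k * x k) ⟨fun k => mul_nonneg (hp t k).le (hx k), hpx⟩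
      have h2 : demandOf (fun k => p t k * x k) (p t) = x := by
        funext k
        have := (hp t k).ne'
        simp only [demandOf]
        field_simp
      rwa [h2] at h1) Finset.univ
  refine ⟨u + h, ⟨⟨hu.1.1.add hcont, ?_⟩, hu.2.add_concaveOn hc⟩, ?_, ?_⟩
  · intro x y hx hy hxy hlt
    exact add_lt_add_of_lt_of_le (hu.1.2 x y hx hy hxy hlt) (hmono x y hx hy hxy)
  · intro t e he
    obtain ⟨h1, h2⟩ := demandOf_mem (hp t) he
    refine add_le_add (hmax t e he) ?_
    exact (hb t (Finset.mem_univ _) _ h1 h2).trans (hle _ (demandOf_mem (hp t) (hE t)).1)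
  · intro C
    obtain ⟨B, hB⟩ := hgr (C - u 0)
    refine ⟨B, fun x hx hk => ?_⟩
    have h1 := hB x hx hk
    have h2 := hu.1.mono (x := 0) (fun _ => le_rfl) hx hx
    simp only [Pi.add_apply]
    linarith

/-- Scaling of the coordinates in `R`. -/
def scaleR {K : ℕ} (R : Finset (Fin K)) (l : ℝ) (x : Fin K → ℝ) : Fin K → ℝ :=
  fun k => if k ∈ R then l * x k else x k

lemma scaleR_nonneg {K : ℕ} (R : Finset (Fin K)) {l : ℝ} (hl : 0 < l) {x : Fin K → ℝ}
    (hx : ∀ k, 0 ≤ x k) (k : Fin K) : 0 ≤ scaleR R l x k := by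
  unfold scaleR
  split_ifs
  · exact mul_nonneg hl.le (hx k)
  · exact hx k

lemma scaleR_comb {K : ℕ} (R : Finset (Fin K)) (l a b : ℝ) (x y : Fin K → ℝ) :
    scaleR R l (a • x + b • y) = a • scaleR R l x + b • scaleR R l y := by
  funext k
  simp only [scaleR, Pi.add_apply, Pi.smul_apply, smul_eq_mul]
  split_ifs <;> ring

lemma scaleR_inj {K : ℕ} (R : Finset (Fin K)) {l : ℝ} (hl : 0 < l) {x y : Fin K → ℝ}
    (h : scaleR R l x = scaleR R l y) : x = y := by
  funext k
  have := congrFun h k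
  simp only [scaleR] at this
  split_ifs at this
  · exact mul_left_cancel₀ hl.ne' this
  · exact this

lemma continuous_scaleR {K : ℕ} (R : Finset (Fin K)) (l : ℝ) : Continuous (scaleR R l) := by
  refine continuous_pi fun k => ?_
  unfold scaleR
  split_ifs <;> fun_prop

lemma nice_scaleR {K : ℕ} (R : Finset (Fin K)) {l : ℝ} (hl : 0 < l) {u : (Fin K → ℝ) → ℝ}
    (hu : IsNiceUtility u) : IsNiceUtility (fun x => u (scaleR R l x)) := by
  refine ⟨⟨hu.1.1.comp (continuous_scaleR R l).continuousOn fun x hx => scaleR_nonneg R hl hx, ?_⟩,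
    convex_orthant K, ?_⟩
  · intro x y hx hy hxy ⟨k, hk⟩
    refine hu.1.2 _ _ (scaleR_nonneg R hl hx) (scaleR_nonneg R hl hy) (fun j => ?_) ⟨k, ?_⟩
    · unfold scaleR
      split_ifs
      · exact mul_le_mul_of_nonneg_left (hxy j) hl.le
      · exact hxy j
    · unfold scaleR
      split_ifs
      · exact mul_lt_mul_of_pos_left hk hl
      · exact hk
  · intro x hx y hy hxy a b ha hb hab
    simp only [scaleR_comb]
    exact hu.2.2 (scaleR_nonneg R hl hx) (scaleR_nonneg R hl hy)
      (fun h => hxy (scaleR_inj R hl h)) ha hb hab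

lemma nice_add_const {K : ℕ} {u : (Fin K → ℝ) → ℝ} (hu : IsNiceUtility u) (b : ℝ) :
    IsNiceUtility (fun x => u x + b) := by
  refine ⟨⟨hu.1.1.add continuousOn_const, ?_⟩, hu.2.add_const b⟩
  intro x y hx hy hxy h
  exact add_lt_add_left (hu.1.2 x y hx hy hxy h) b

lemma nice_inf {K : ℕ} {u v : (Fin K → ℝ) → ℝ} (hu : IsNiceUtility u) (hv : IsNiceUtility v) :
    IsNiceUtility (u ⊓ v) := by
  refine ⟨⟨hu.1.1.inf hv.1.1, ?_⟩, hu.2.inf hv.2⟩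
  intro x y hx hy hxy h
  exact lt_inf_iff.2 ⟨inf_le_left.trans_lt (hu.1.2 x y hx hy hxy h),
    inf_le_right.trans_lt (hv.1.2 x y hx hy hxy h)⟩

lemma plamR_pos {T K : ℕ} (R : Finset (Fin K)) {pbar : Fin T → Fin K → ℝ}
    (hp : ∀ t k, 0 < pbar t k) {l : ℝ} (hl : 0 < l) (t : Fin T) (k : Fin K) :
    0 < plamR R pbar l t k := by
  unfold plamR
  split_ifs
  · exact mul_pos hl (hp t k)
  · exact hp t k

lemma scaleR_demandOf {T K : ℕ} (R : Finset (Fin K)) {pbar : Fin T → Fin K → ℝ}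
    (hp : ∀ t k, 0 < pbar t k) {a b : ℝ} (ha : 0 < a) (hb : 0 < b) (t : Fin T) (e : Fin K → ℝ) :
    scaleR R a (demandOf e (plamR R pbar (a * b) t)) = demandOf e (plamR R pbar b t) := by
  funext k
  have := (hp t k).ne'
  simp only [scaleR, demandOf, plamR]
  split_ifs
  · field_simp
  · rfl

lemma plamR_one {T K : ℕ} (R : Finset (Fin K)) (pbar : Fin T → Fin K → ℝ) (t : Fin T) :
    plamR R pbar 1 t = pbar t := by
  funext k
  simp [plamR]

/-- One utility function serving finitely many types through widely separated multipliers. -/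
lemma exists_common {T K : ℕ} {V : Type} [DecidableEq V] (m : Fin T → ℝ)
    (hm : ∀ t, 0 < m t) (pbar : Fin T → Fin K → ℝ) (hpbar : ∀ t k, 0 < pbar t k)
    (R : Finset (Fin K)) (hR : R.Nonempty) (u : V → (Fin K → ℝ) → ℝ)
    (hu : ∀ v, IsNiceUtility (u v)) (u0 : (Fin K → ℝ) → ℝ) (hu0 : IsNiceUtility u0)
    (E : V → Fin T → Fin K → ℝ)
    (hE : ∀ v t, E v t ∈ simplexE (m t)) (hpos : ∀ v t, ∀ k ∈ R, 0 < E v t k)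
    (hmax : ∀ v t, ∀ e ∈ simplexE (m t),
      u v (demandOf e (pbar t)) ≤ u v (demandOf (E v t) (pbar t))) (s : Finset V) :
    ∃ (U : (Fin K → ℝ) → ℝ) (L : V → ℝ), IsNiceUtility U ∧ (∀ v, 0 < L v) ∧
      ∀ v ∈ s, ∀ t, ∀ e ∈ simplexE (m t), U (demandOf e (plamR R pbar (L v) t)) ≤
        U (demandOf (E v t) (plamR R pbar (L v) t)) := by
  obtain ⟨k0, hk0⟩ := hR
  induction s using Finset.induction_on with
  | empty => exact ⟨u0, fun _ => 1, hu0, fun _ => one_pos, by simp⟩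
  | insert v s hv ih =>
    obtain ⟨U, L, hU, hL, hUm⟩ := ih
    obtain ⟨w, hw, hwm, hgr⟩ := exists_coercive k0 (hu v) pbar hpbar m hm (E v) (hE v) (hmax v)
    obtain ⟨M, hM⟩ : ∃ M : ℝ, ∀ t, w (demandOf (E v t) (pbar t)) ≤ M := by
      obtain ⟨M, hM⟩ := (Set.finite_range fun t => w (demandOf (E v t) (pbar t))).bddAbove
      exact ⟨M, fun t => hM ⟨t, rfl⟩⟩
    -- the bundles already placed
    let x : V → Fin T → Fin K → ℝ := fun v' t => demandOf (E v' t) (plamR R pbar (L v') t)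
    have hx : ∀ v' t k, 0 ≤ x v' t k := fun v' t =>
      (demandOf_mem (plamR_pos R hpbar (hL v') t) (hE v' t)).1
    have hxp : ∀ v' t, 0 < x v' t k0 := fun v' t =>
      div_pos (hpos v' t k0 hk0) (plamR_pos R hpbar (hL v') t k0)
    have hev : ∀ᶠ l : ℝ in atTop, ∀ v' ∈ s, ∀ t,
        M + U (x v' t) - U 0 ≤ w (scaleR R l (x v' t)) := by
      rw [Filter.eventually_all_finset]
      intro v' _
      rw [Filter.eventually_all]
      intro t
      obtain ⟨B, hB⟩ := hgr (M + U (x v' t) - U 0)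
      filter_upwards [eventually_gt_atTop 0, eventually_ge_atTop (B / x v' t k0)] with l hl hlB
      refine hB _ (scaleR_nonneg R hl (hx v' t)) ⟨k0, ?_⟩
      rw [div_le_iff₀ (hxp v' t)] at hlB
      simpa [scaleR, hk0] using hlB
    obtain ⟨l, hl, hl0⟩ := (hev.and (eventually_gt_atTop (0 : ℝ))).exists
    refine ⟨U ⊓ fun y => w (scaleR R l y) + (U 0 - M), Function.update L v l,
      nice_inf hU (nice_add_const (nice_scaleR R hl0 hw) _), ?_, ?_⟩
    · intro v'
      by_cases h : v' = v
      · subst h; simpa using hl0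
      · simpa [h] using hL v'
    · intro v' hv' t e he
      rcases Finset.mem_insert.1 hv' with rfl | hv''
      · simp only [Function.update_self, Pi.inf_apply]
        have h1 := fun e => scaleR_demandOf R hpbar hl0 one_pos t e
        simp only [mul_one, plamR_one] at h1
        simp only [h1]
        have h2 := hwm t e he
        have h3 := hM t
        have h4 := hU.1.mono (x := 0) (fun _ => le_rfl)
          (demandOf_mem (plamR_pos R hpbar hl0 t) (hE v' t)).1
          (demandOf_mem (plamR_pos R hpbar hl0 t) (hE v' t)).1
        refine inf_le_right.trans (le_inf ?_ ?_)
        · linarith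
        · linarith
      · have hne : v' ≠ v := fun h => hv (h ▸ hv'')
        simp only [Function.update_of_ne hne, Pi.inf_apply]
        have h1 := hUm v' hv'' t e he
        have h2 := hl v' hv'' t
        simp only [x] at h2
        refine inf_le_left.trans (le_inf h1 (h1.trans ?_))
        linarith

lemma isClosed_simplexE {K : ℕ} (m : ℝ) : IsClosed (simplexE (K := K) m) := by
  have h : simplexE (K := K) m = (⋂ k, {e | 0 ≤ e k}) ∩ {e | ∑ k, e k = m} := by
    ext e; simp [simplexE]
  rw [h]
  refine IsClosed.inter (isClosed_iInter fun k => isClosed_le continuous_const (by fun_prop))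
    (isClosed_eq (by fun_prop) continuous_const)

lemma simplexE_le {K : ℕ} {m : ℝ} {e : Fin K → ℝ} (he : e ∈ simplexE m) (k : Fin K) :
    e k ≤ m := by
  rw [← he.2]
  exact Finset.single_le_sum (f := e) (fun k _ => he.1 k) (Finset.mem_univ k)

lemma isCompact_simplexE {K : ℕ} (m : ℝ) : IsCompact (simplexE (K := K) m) := by
  refine IsCompact.of_isClosed_subset (isCompact_Icc (a := (0 : Fin K → ℝ)) (b := fun _ => m))
    (isClosed_simplexE m) fun e he => ⟨fun k => he.1 k, fun k => simplexE_le he k⟩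

lemma simplexE_nonempty {K : ℕ} (k0 : Fin K) {m : ℝ} (hm : 0 < m) :
    (simplexE (K := K) m).Nonempty := by
  refine ⟨Pi.single k0 m, fun k => ?_, by simp⟩
  by_cases h : k = k0
  · subst h; simpa using hm.le
  · simp [h]

lemma maximizer_unique {K : ℕ} {U : (Fin K → ℝ) → ℝ} (hU : IsNiceUtility U) {p : Fin K → ℝ}
    (hp : ∀ k, 0 < p k) {m : ℝ} {e e' : Fin K → ℝ} (he : e ∈ simplexE m) (he' : e' ∈ simplexE m)
    (h : ∀ f ∈ simplexE m, U (demandOf f p) ≤ U (demandOf e p))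
    (h' : ∀ f ∈ simplexE m, U (demandOf f p) ≤ U (demandOf e' p)) : e = e' := by
  by_contra hne
  have hd : demandOf e p ≠ demandOf e' p := by
    intro h
    apply hne
    funext k
    have := congrFun h k
    simp only [demandOf] at this
    have hk := (hp k).ne'
    field_simp at this
    exact this
  have h1 := hU.2.2 (demandOf_mem hp he).1 (demandOf_mem hp he').1 hd
    (by norm_num : (0 : ℝ) < 1 / 2) (by norm_num : (0 : ℝ) < 1 / 2) (by norm_num)
  have hmem : (fun k => 1 / 2 * e k + 1 / 2 * e' k) ∈ simplexE m := by
    refine ⟨fun k => ?_, ?_⟩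
    · have := he.1 k
      have := he'.1 k
      positivity
    · rw [Finset.sum_add_distrib, ← Finset.mul_sum, ← Finset.mul_sum, he.2, he'.2]
      ring
  have h2 := h _ hmem
  have h3 := h' e he
  have h5 := h e' he'
  have h4 : demandOf (fun k => 1 / 2 * e k + 1 / 2 * e' k) p
      = (1 / 2 : ℝ) • demandOf e p + (1 / 2 : ℝ) • demandOf e' p := by
    funext k
    simp only [demandOf, Pi.add_apply, Pi.smul_apply, smul_eq_mul]
    ring
  rw [h4] at h2
  simp only [smul_eq_mul] at h1
  linarith

/-- Measurable demand in the multiplier. -/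
lemma exists_demand {T K : ℕ} (k0 : Fin K) (m : Fin T → ℝ)
    (hm : ∀ t, 0 < m t) (pbar : Fin T → Fin K → ℝ) (hpbar : ∀ t k, 0 < pbar t k)
    (R : Finset (Fin K)) {U : (Fin K → ℝ) → ℝ} (hU : IsNiceUtility U) :
    ∃ E : ℝ → Fin T → Fin K → ℝ, (∀ lam : ℝ, 0 < lam → ∀ t, E lam t ∈ simplexE (m t) ∧
          ∀ e ∈ simplexE (m t),
            U (demandOf e (plamR R pbar lam t)) ≤
              U (demandOf (E lam t) (plamR R pbar lam t))) ∧
        (∀ t, Measurable fun lam => E lam t) := by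
  suffices H : ∀ t, ∃ E : ℝ → Fin K → ℝ, (∀ lam : ℝ, 0 < lam → E lam ∈ simplexE (m t) ∧
          ∀ e ∈ simplexE (m t),
            U (demandOf e (plamR R pbar lam t)) ≤
              U (demandOf (E lam) (plamR R pbar lam t))) ∧ Measurable E by
    choose E h1 h2 using H
    exact ⟨fun l t => E t l, fun l hl t => h1 t l hl, h2⟩
  intro t
  have : CompactSpace (simplexE (K := K) (m t)) :=
    isCompact_iff_compactSpace.1 (isCompact_simplexE (m t))
  let D : Ioi (0 : ℝ) × simplexE (K := K) (m t) → Fin K → ℝ :=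
    fun q => demandOf q.2.1 (plamR R pbar q.1.1 t)
  have hD : Continuous D := by
    refine continuous_pi fun k => ?_
    have hne : ∀ q : Ioi (0 : ℝ) × simplexE (K := K) (m t), plamR R pbar q.1.1 t k ≠ 0 :=
      fun q => (plamR_pos R hpbar q.1.2 t k).ne'
    refine Continuous.div ((continuous_apply k).comp (continuous_subtype_val.comp continuous_snd)) ?_ hne
    unfold plamR
    split_ifs <;> fun_prop
  have hf : Continuous fun q : Ioi (0 : ℝ) × simplexE (K := K) (m t) => U (D q) :=
    hU.1.1.comp_continuous hD fun q => (demandOf_mem (plamR_pos R hpbar q.1.2 t) q.2.2).1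
  have : Nonempty (simplexE (K := K) (m t)) := (simplexE_nonempty k0 (hm t)).to_subtype
  have hex : ∀ l : Ioi (0 : ℝ), ∃ e : simplexE (K := K) (m t), ∀ e', U (D (l, e')) ≤ U (D (l, e)) := by
    intro l
    have hc : Continuous fun e : simplexE (K := K) (m t) => U (D (l, e)) :=
      hf.comp (continuous_const.prodMk continuous_id)
    obtain ⟨e, _, he⟩ := isCompact_univ.exists_isMaxOn Set.univ_nonempty hc.continuousOn
    exact ⟨e, fun e' => he (Set.mem_univ e')⟩
  choose g hg using hex
  have hgc : Continuous g := by
    refine continuous_argmax (fun l e => U (D (l, e))) hf g hg ?_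
    intro l e he
    apply Subtype.ext
    exact maximizer_unique hU (plamR_pos R hpbar l.2 t) e.2 (g l).2
      (fun f hf => he ⟨f, hf⟩) (fun f hf => hg l ⟨f, hf⟩)
  classical
  let G : ℝ → Fin K → ℝ := fun l => if h : 0 < l then (g ⟨l, h⟩).1 else 0
  refine ⟨G, ?_, ?_⟩
  · intro l hl
    simp only [G, dif_pos hl]
    exact ⟨(g ⟨l, hl⟩).2, fun e he => hg ⟨l, hl⟩ ⟨e, he⟩⟩
  · refine Measurable.dite (s := Ioi (0 : ℝ)) (f := fun l => (g l).1) (g := fun _ => 0) ?_ ?_ measurableSet_Ioi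
    · exact (continuous_subtype_val.comp hgc).measurable
    · exact measurable_const

/-- Couplings that are uniformly close give close laws. -/
lemma levyProkhorovDist_map_le {Ω X : Type*} [MeasurableSpace Ω] {P : Measure Ω}
    [IsProbabilityMeasure P] [PseudoMetricSpace X] [MeasurableSpace X] [OpensMeasurableSpace X]
    {f g : Ω → X} (hf : Measurable f) (hg : Measurable g) {δ : ℝ} (hδ : 0 ≤ δ)
    (h : ∀ᵐ ω ∂P, dist (f ω) (g ω) ≤ δ) :
    levyProkhorovDist (P.map f) (P.map g) ≤ δ := by
  have := Measure.isProbabilityMeasure_map (μ := P) hf.aemeasurable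
  have := Measure.isProbabilityMeasure_map (μ := P) hg.aemeasurable
  refine levyProkhorovDist_le_of_forall_le _ _ hδ fun ε B hε hB => ?_
  refine le_trans ?_ le_self_add
  rw [Measure.map_apply hf hB, Measure.map_apply hg Metric.isOpen_thickening.measurableSet]
  refine measure_mono_ae ?_
  filter_upwards [h] with ω hω hB
  exact Metric.mem_thickening_iff.2 ⟨f ω, hB, by rw [dist_comm]; exact hω.trans_lt hε⟩

/-- Proposition 8, second part: if a cross-sectional data set is
RUM-rationalizable, then for every `ε > 0` there are probability measures within
Lévy–Prokhorov distance `ε` of the originals that are RPM-rationalizable with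
consistency in expectation. -/
theorem rum_implies_approx_rpm {T K : ℕ}
    (m : Fin T → ℝ) (hm : ∀ t, 0 < m t)
    (pbar : Fin T → Fin K → ℝ) (hpbar : ∀ t k, 0 < pbar t k)
    (μ : Fin T → Measure (Fin K → ℝ)) (hprob : ∀ t, IsProbabilityMeasure (μ t))
    (R : Finset (Fin K)) (hR : R.Nonempty)
    (hsupp : ∀ t, μ t {e | e ∈ simplexE (m t) ∧ ∀ k ∈ R, 0 < e k} = 1)
    (hRUM : ∃ (Ω : Type) (_ : MeasurableSpace Ω) (P : Measure Ω)
        (_ : IsProbabilityMeasure P)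
        (u : Ω → (Fin K → ℝ) → ℝ) (E : Ω → Fin T → (Fin K → ℝ)),
        (∀ ω, IsNiceUtility (u ω)) ∧
        (∀ ω t, E ω t ∈ simplexE (m t) ∧
          ∀ e ∈ simplexE (m t),
            u ω (demandOf e (pbar t)) ≤ u ω (demandOf (E ω t) (pbar t))) ∧
        (∀ t, Measurable fun ω => E ω t) ∧
        (∀ t, μ t = P.map fun ω => E ω t))
    (ε : ℝ) (hε : 0 < ε) :
    ∃ (μhat : Fin T → Measure (Fin K → ℝ)) (_ : ∀ t, IsProbabilityMeasure (μhat t)),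
      (∀ t, μhat t (simplexE (m t)) = 1) ∧
      (∀ t, levyProkhorovDist (μ t) (μhat t) < ε) ∧
      ∃ (η : Measure ℝ) (_ : IsProbabilityMeasure η)
        (u : (Fin K → ℝ) → ℝ) (E : ℝ → Fin T → (Fin K → ℝ)),
        η (Set.Ioi (0 : ℝ)) = 1 ∧ (∫ lam, lam ∂η) = 1 ∧ IsNiceUtility u ∧
        (∀ lam : ℝ, 0 < lam → ∀ t, E lam t ∈ simplexE (m t) ∧
          ∀ e ∈ simplexE (m t),
            u (demandOf e (plamR R pbar lam t)) ≤
              u (demandOf (E lam t) (plamR R pbar lam t))) ∧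
        (∀ t, Measurable fun lam => E lam t) ∧
        (∀ t, μhat t = η.map fun lam => E lam t) := by
  obtain ⟨Ω, _, P, _, u, E, hu, hE, hEm, hμ⟩ := hRUM
  classical
  obtain ⟨k0, hk0⟩ := hR
  -- the good event
  have hgood : ∀ᵐ ω ∂P, ∀ t, ∀ k ∈ R, 0 < E ω t k := by
    rw [ae_all_iff]
    intro t
    have hms : MeasurableSet {e : Fin K → ℝ | e ∈ simplexE (m t) ∧ ∀ k ∈ R, 0 < e k} := by
      have : {e : Fin K → ℝ | e ∈ simplexE (m t) ∧ ∀ k ∈ R, 0 < e k}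
          = simplexE (m t) ∩ ⋂ k ∈ R, {e | 0 < e k} := by
        ext e; simp
      rw [this]
      refine (isClosed_simplexE _).measurableSet.inter ?_
      refine Finset.measurableSet_biInter _ fun k _ => ?_
      exact measurableSet_lt measurable_const (measurable_pi_apply k)
    have := hprob t
    have h1 := (mem_ae_iff_prob_eq_one hms).2 (hsupp t)
    rw [hμ t] at h1
    have h2 := ae_of_ae_map (hEm t).aemeasurable h1
    filter_upwards [h2] with ω hω using hω.2
  obtain ⟨ω0, hω0⟩ := hgood.exists
  -- buckets
  set δ := ε / 2 with hδ
  have hδ0 : 0 < δ := by positivity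
  obtain ⟨B, hB⟩ : ∃ B : ℕ, ∀ t, ⌊m t / δ⌋₊ ≤ B := by
    obtain ⟨M, hM⟩ := (Set.finite_range fun t => ⌊m t / δ⌋₊).bddAbove
    exact ⟨M, fun t => hM ⟨t, rfl⟩⟩
  let V := Fin T → Fin K → Fin (B + 1)
  let c : Ω → V := fun ω t k => Fin.ofNat (B + 1) ⌊E ω t k / δ⌋₊
  have hc : Measurable c := by
    refine measurable_pi_lambda _ fun t => measurable_pi_lambda _ fun k => ?_
    refine (measurable_from_top (f := fun n : ℕ => Fin.ofNat (B + 1) n)).comp ?_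
    exact Nat.measurable_floor.comp
      (((measurable_pi_apply k).comp (hEm t)).div_const δ)
  have hfl : ∀ ω t k, ⌊E ω t k / δ⌋₊ ≤ B := fun ω t k =>
    (Nat.floor_le_floor (div_le_div_of_nonneg_right (simplexE_le (hE ω t).1 k) hδ0.le)).trans (hB t)
  have hclose : ∀ ω ω', c ω = c ω' → ∀ t, dist (E ω t) (E ω' t) ≤ δ := by
    intro ω ω' h t
    rw [dist_pi_le_iff hδ0.le]
    intro k
    have h1 := congrArg Fin.val (congrFun (congrFun h t) k)
    simp only [c, Fin.val_ofNat] at h1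
    rw [Nat.mod_eq_of_lt (Nat.lt_succ_of_le (hfl ω t k)),
      Nat.mod_eq_of_lt (Nat.lt_succ_of_le (hfl ω' t k))] at h1
    have a1 := Nat.floor_le (div_nonneg ((hE ω t).1.1 k) hδ0.le)
    have a2 := Nat.lt_floor_add_one (E ω t k / δ)
    have b1 := Nat.floor_le (div_nonneg ((hE ω' t).1.1 k) hδ0.le)
    have b2 := Nat.lt_floor_add_one (E ω' t k / δ)
    rw [h1] at a1 a2
    rw [le_div_iff₀ hδ0] at a1 b1
    rw [div_lt_iff₀ hδ0] at a2 b2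
    rw [Real.dist_eq, abs_le]
    constructor <;> nlinarith
  -- representatives
  have hrep : ∀ v : V, ∃ ω, (∀ t, ∀ k ∈ R, 0 < E ω t k) ∧
      ((∃ ω', (∀ t, ∀ k ∈ R, 0 < E ω' t k) ∧ c ω' = v) → c ω = v) := by
    intro v
    by_cases h : ∃ ω', (∀ t, ∀ k ∈ R, 0 < E ω' t k) ∧ c ω' = v
    · obtain ⟨ω', h1, h2⟩ := h
      exact ⟨ω', h1, fun _ => h2⟩
    · exact ⟨ω0, hω0, fun h' => absurd h' h⟩
  choose ρ hρ1 hρ2 using hrep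
  obtain ⟨U, L, hU, hL, hUm⟩ := exists_common m hm pbar hpbar R ⟨k0, hk0⟩ (fun v => u (ρ v))
    (fun v => hu _) (u ω0) (hu ω0) (fun v => E (ρ v)) (fun v t => (hE _ t).1) hρ1
    (fun v t => (hE _ t).2) (Finset.univ : Finset V)
  have hLm : Measurable fun ω => L (c ω) := (measurable_of_finite L).comp hc
  -- normalization
  obtain ⟨C, hC⟩ : ∃ C, ∀ v, L v ≤ C := by
    obtain ⟨C, hC⟩ := (Set.finite_range L).bddAbove
    exact ⟨C, fun v => hC ⟨v, rfl⟩⟩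
  have hLint : Integrable (fun ω => L (c ω)) P := by
    refine Integrable.of_bound hLm.aestronglyMeasurable C (ae_of_all _ fun ω => ?_)
    rw [Real.norm_eq_abs, abs_of_pos (hL _)]
    exact hC _
  set I := ∫ ω, L (c ω) ∂P with hI
  have hI0 : 0 < I := by
    rw [hI, integral_pos_iff_support_of_nonneg (fun ω => (hL _).le) hLint]
    have : Function.support (fun ω => L (c ω)) = Set.univ := by
      ext ω; simp [(hL (c ω)).ne']
    rw [this]; simp
  have hU' := nice_scaleR R (inv_pos.2 hI0) hU
  obtain ⟨Eh, hEh, hEhm⟩ := exists_demand k0 m hm pbar hpbar R hU'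
  have hfm : Measurable fun ω => I⁻¹ * L (c ω) := hLm.const_mul _
  have hval : ∀ v t, Eh (I⁻¹ * L v) t = E (ρ v) t := by
    intro v t
    have hpos := mul_pos (inv_pos.2 hI0) (hL v)
    obtain ⟨h1, h2⟩ := hEh _ hpos t
    refine maximizer_unique hU' (plamR_pos R hpbar hpos t) h1 (hE _ t).1 h2 ?_
    intro e he
    simp only [scaleR_demandOf R hpbar (inv_pos.2 hI0) (hL v)]
    exact hUm v (Finset.mem_univ _) t e he
  have hgm : ∀ t, Measurable fun ω => E (ρ (c ω)) t := fun t =>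
    (measurable_of_finite fun v => E (ρ v) t).comp hc
  refine ⟨fun t => P.map fun ω => E (ρ (c ω)) t,
    fun t => Measure.isProbabilityMeasure_map (hgm t).aemeasurable, ?_, ?_,
    P.map fun ω => I⁻¹ * L (c ω), Measure.isProbabilityMeasure_map hfm.aemeasurable,
    _, Eh, ?_, ?_, hU', hEh, hEhm, ?_⟩
  · intro t
    rw [Measure.map_apply (hgm t) (isClosed_simplexE _).measurableSet]
    have : (fun ω => E (ρ (c ω)) t) ⁻¹' simplexE (m t) = Set.univ := by
      ext ω; simpa using (hE (ρ (c ω)) t).1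
    rw [this]; simp
  · intro t
    rw [hμ t]
    refine (levyProkhorovDist_map_le (hEm t) (hgm t) hδ0.le ?_).trans_lt (by rw [hδ]; linarith)
    filter_upwards [hgood] with ω hω
    exact hclose _ _ (hρ2 (c ω) ⟨ω, hω, rfl⟩).symm t
  · rw [Measure.map_apply hfm measurableSet_Ioi]
    have : (fun ω => I⁻¹ * L (c ω)) ⁻¹' Set.Ioi 0 = Set.univ := by
      ext ω; simpa using mul_pos (inv_pos.2 hI0) (hL (c ω))
    rw [this]; simp
  · rw [integral_map hfm.aemeasurable (by fun_prop), integral_const_mul, ← hI,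
      inv_mul_cancel₀ hI0.ne']
  · intro t
    rw [Measure.map_map (hEhm t) hfm]
    have : (fun ω => E (ρ (c ω)) t) = (fun lam => Eh lam t) ∘ fun ω => I⁻¹ * L (c ω) :=
      funext fun ω => (hval (c ω) t).symm
    rw [← this]
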